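/- arXiv:2308.01620 — 5 statements merged into one kernel-verified Lean document; each statement's English description precedes it below -/
import Mathlib

section
/- The set V of nonincreasing nonnegative real sequences with ℓ¹-norm at most 1 is compact in the topology induced by the supremum norm ‖·‖_∞ (equivalently, the topology of uniform convergence of sequences ℕ → ℝ). -/
open BoundedContinuousFunction

/-- The terms of a nonincreasing sequence with partial sums at most `1` decay like `1 / (n + 1)`. -/
theorem le_one_div_of_antitone_of_sum_le_one {f : ℕ → ℝ} (hf : Antitone f)
    (hsum : ∀ N, ∑ i ∈ Finset.range N, f i ≤ 1) (n : ℕ) : f n ≤ 1 / ((n : ℝ) + 1) := by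
  have h : (Finset.range (n + 1)).card • f n ≤ ∑ i ∈ Finset.range (n + 1), f i :=
    Finset.card_nsmul_le_sum _ _ _ fun i hi => hf (Nat.lt_succ_iff.mp (Finset.mem_range.mp hi))
  rw [Finset.card_range, nsmul_eq_mul, Nat.cast_add_one] at h
  rw [le_div_iff₀ (by positivity), mul_comm]
  exact h.trans (hsum _)

/-- Nonincreasing nonnegative real sequences with partial sums at most `1`. -/
def antitoneSubprobability : Set (ℕ → ℝ) :=
  {f | (∀ i, 0 ≤ f i) ∧ (∀ i, f (i + 1) ≤ f i) ∧ ∀ N, ∑ i ∈ Finset.range N, f i ≤ 1}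

namespace antitoneSubprobability

theorem le_one_div {f : ℕ → ℝ} (hf : f ∈ antitoneSubprobability) (n : ℕ) :
    f n ≤ 1 / ((n : ℝ) + 1) :=
  le_one_div_of_antitone_of_sum_le_one (antitone_nat_of_succ_le hf.2.1) hf.2.2 n

theorem mem_Icc {f : ℕ → ℝ} (hf : f ∈ antitoneSubprobability) (n : ℕ) :
    f n ∈ Set.Icc (0 : ℝ) 1 := by
  refine ⟨hf.1 n, (le_one_div hf n).trans ?_⟩
  rw [div_le_one (by positivity)]
  linarith [(Nat.cast_nonneg n : (0 : ℝ) ≤ n)]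

/-- Compactness in the topology of pointwise convergence. -/
theorem isCompact : IsCompact antitoneSubprobability := by
  refine (isCompact_univ_pi fun _ : ℕ => isCompact_Icc (a := (0 : ℝ)) (b := 1)).of_isClosed_subset
    ?_ fun f hf n _ => mem_Icc hf n
  simp only [antitoneSubprobability, Set.ofPred_and, Set.ofPred_forall]
  refine (isClosed_iInter fun i => isClosed_le ?_ ?_).inter
    ((isClosed_iInter fun i => isClosed_le ?_ ?_).inter
      (isClosed_iInter fun N => isClosed_le ?_ ?_)) <;> fun_prop

/-- The inclusion into the space of bounded sequences. -/
noncomputable def toBCF (f : antitoneSubprobability) : ℕ →ᵇ ℝ :=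
  BoundedContinuousFunction.mkOfDiscrete f.1 1 fun i j =>
    (Real.dist_le_of_mem_Icc (mem_Icc f.2 i) (mem_Icc f.2 j)).trans_eq (sub_zero 1)


/-- Pointwise convergence of nonincreasing sub-probability sequences is uniform. -/
theorem continuous_toBCF : Continuous toBCF := by
  refine continuous_iff_continuousAt.mpr fun f => Metric.tendsto_nhds.mpr fun ε hε => ?_
  obtain ⟨N, hN⟩ := exists_nat_one_div_lt (half_pos hε)
  have hev : ∀ᶠ g : antitoneSubprobability in nhds f,
      ∀ i ∈ Finset.range N, dist (g.1 i) (f.1 i) < ε / 2 := by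
    refine (Filter.eventually_all_finset _).mpr fun i _ => ?_
    have hc : Continuous fun g : antitoneSubprobability => g.1 i :=
      (continuous_apply i).comp continuous_subtype_val
    exact Metric.tendsto_nhds.mp (hc.tendsto f) _ (half_pos hε)
  filter_upwards [hev] with g hg
  refine lt_of_le_of_lt ((dist_le (half_pos hε).le).mpr fun i => ?_) (half_lt_self hε)
  rcases lt_or_ge i N with hi | hi
  · exact (hg i (Finset.mem_range.mpr hi)).le
  · have small (h : antitoneSubprobability) : h.1 i ∈ Set.Icc 0 (ε / 2) :=
      ⟨h.2.1 i, ((antitone_nat_of_succ_le h.2.2.1 hi).trans (le_one_div h.2 N)).trans hN.le⟩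
    exact (Real.dist_le_of_mem_Icc (small g) (small f)).trans_eq (sub_zero _)

end antitoneSubprobability

/-- The set `V` of nonincreasing nonnegative real sequences with ℓ¹-norm at most 1
is compact in the topology of the supremum norm (i.e. as a subset of the space of
bounded functions `ℕ →ᵇ ℝ`, whose norm is the sup norm). -/
theorem V_isCompact :
    IsCompact {f : ℕ →ᵇ ℝ |
      (∀ i, 0 ≤ f i) ∧ (∀ i, f (i + 1) ≤ f i) ∧ ∀ N, ∑ i ∈ Finset.range N, f i ≤ 1} := by
  have : CompactSpace antitoneSubprobability :=
    isCompact_iff_compactSpace.mp antitoneSubprobability.isCompact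
  convert isCompact_range antitoneSubprobability.continuous_toBCF using 1
  ext f
  constructor
  · intro hf
    exact ⟨⟨f, hf⟩, BoundedContinuousFunction.ext fun _ => rfl⟩
  · rintro ⟨g, rfl⟩
    exact g.2
end

section
/- Let α, β ∈ V. If α is a contraction of β and β is a contraction of α, then α = β. -/
/-- `V` : the set of nonincreasing nonnegative real sequences with ℓ¹-norm at most 1. -/
def memV (a : ℕ → ℝ) : Prop :=
  (∀ i, 0 ≤ a i) ∧ (∀ i, a (i + 1) ≤ a i) ∧ ∀ N, ∑ i ∈ Finset.range N, a i ≤ 1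

/-- `β` is a contraction of `α` if there is a map `π : ℕ → ℕ` such that
`β j = ∑_{i ∈ π⁻¹(j)} α i` for every `j`. -/
def IsContraction (α β : ℕ → ℝ) : Prop :=
  ∃ π : ℕ → ℕ, ∀ j, HasSum (fun i : (π ⁻¹' {j} : Set ℕ) => α i) (β j)

/-- For a nonincreasing nonnegative sequence, the first `N` terms have the largest sum among
all sets of at most `N` terms. -/
theorem Antitone.sum_le_sum_range_of_card_le {a : ℕ → ℝ} (ha : Antitone a) (h0 : ∀ i, 0 ≤ a i)
    {s : Finset ℕ} {N : ℕ} (hs : s.card ≤ N) : ∑ i ∈ s, a i ≤ ∑ i ∈ Finset.range N, a i := by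
  have hcard : (s \ Finset.range N).card ≤ (Finset.range N \ s).card := by
    rw [Finset.card_sdiff_le_card_sdiff_iff, Finset.card_range]
    exact hs
  have hdiff : ∑ i ∈ s \ Finset.range N, a i ≤ ∑ i ∈ Finset.range N \ s, a i :=
    calc ∑ i ∈ s \ Finset.range N, a i
        ≤ (s \ Finset.range N).card • a N :=
          Finset.sum_le_card_nsmul _ _ _ fun i hi => ha (by simpa using (Finset.mem_sdiff.1 hi).2)
      _ ≤ (Finset.range N \ s).card • a N := nsmul_le_nsmul_left (h0 N) hcard
      _ ≤ ∑ i ∈ Finset.range N \ s, a i :=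
          Finset.card_nsmul_le_sum _ _ _ fun i hi =>
            ha (Finset.mem_range.1 (Finset.mem_sdiff.1 hi).1).le
  rw [← Finset.sum_inter_add_sum_sdiff s (Finset.range N),
    ← Finset.sum_inter_add_sum_sdiff (Finset.range N) s, Finset.inter_comm]
  gcongr

/-- A contraction majorizes the original sequence. -/
theorem IsContraction.sum_range_le {α β : ℕ → ℝ} (h : IsContraction α β) (hα : ∀ i, 0 ≤ α i)
    (hβ : memV β) (N : ℕ) : ∑ i ∈ Finset.range N, α i ≤ ∑ i ∈ Finset.range N, β i := by
  obtain ⟨π, hπ⟩ := h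
  calc ∑ i ∈ Finset.range N, α i
      = ∑ j ∈ (Finset.range N).image π, ∑ i ∈ Finset.range N with π i = j, α i :=
        (Finset.sum_fiberwise_of_maps_to (fun _ => Finset.mem_image_of_mem π) α).symm
    _ ≤ ∑ j ∈ (Finset.range N).image π, β j := by
        refine Finset.sum_le_sum fun j _ => ?_
        have hj : HasSum ((π ⁻¹' {j}).indicator α) (β j) :=
          hasSum_subtype_iff_indicator.1 (hπ j)
        calc ∑ i ∈ Finset.range N with π i = j, α i
            = ∑ i ∈ Finset.range N with π i = j, (π ⁻¹' {j}).indicator α i :=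
              Finset.sum_congr rfl fun i hi =>
                (Set.indicator_of_mem (s := π ⁻¹' {j}) (Finset.mem_filter.1 hi).2 α).symm
          _ ≤ β j := sum_le_hasSum _ (fun i _ => Set.indicator_nonneg (fun i _ => hα i) i) hj
    _ ≤ ∑ i ∈ Finset.range N, β i :=
        (antitone_nat_of_succ_le hβ.2.1).sum_le_sum_range_of_card_le hβ.1
          (Finset.card_image_le.trans (Finset.card_range N).le)

/-- If `α` is a contraction of `β` and `β` is a contraction of `α`, then `α = β`. -/
theorem eq_of_bi_contraction (α β : ℕ → ℝ) (hα : memV α) (hβ : memV β)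
    (h₁ : IsContraction β α) (h₂ : IsContraction α β) : α = β := by
  have hsum (N : ℕ) : ∑ i ∈ Finset.range N, α i = ∑ i ∈ Finset.range N, β i :=
    le_antisymm (h₂.sum_range_le hα.1 hβ N) (h₁.sum_range_le hβ.1 hα N)
  ext n
  have hn := hsum (n + 1)
  rwa [Finset.sum_range_succ, Finset.sum_range_succ, hsum n, add_right_inj] at hn
end

section
/- For every n ≥ 1, the variance of the n-dimensional standard Gaussian space equals 1: letting γⁿ be the product of n copies of the centered Gaussian measure of variance 1 on ℝ, and giving ℝⁿ the Euclidean metric, one has sup{ (1/2)∫_{ℝⁿ×ℝⁿ}(f(x)−f(y))² d(γⁿ⊗γⁿ)(x,y) : f : ℝⁿ → ℝ is 1-Lipschitz } = 1. -/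
open MeasureTheory ENNReal ProbabilityTheory

/-- The variance of a function `f` over `(X, m)` :
`V_X(f) = (1/2) ∫_{X×X} (f x − f y)² d(m ⊗ m)`, valued in `[0,∞]`. -/
noncomputable def funVariance {X : Type*} [MeasurableSpace X]
    (m : Measure X) (f : X → ℝ) : ℝ≥0∞ :=
  (1 / 2) * ∫⁻ p : X × X, ENNReal.ofReal ((f p.1 - f p.2) ^ 2) ∂(m.prod m)

/-- The standard Gaussian measure `γⁿ` on `ℝⁿ` with the Euclidean metric: the product of
`n` copies of the centered Gaussian measure of variance 1, transported to
`EuclideanSpace ℝ (Fin n)`. -/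
noncomputable def gaussianPi (n : ℕ) : Measure (EuclideanSpace ℝ (Fin n)) :=
  Measure.map (MeasurableEquiv.toLp 2 (Fin n → ℝ))
    (Measure.pi fun _ : Fin n => gaussianReal 0 1)

open Filter Topology
open scoped NNReal

/-- A nonnegative log-convex sequence bounded by a geometric sequence of ratio `r` starts with
a ratio at most `r`. -/
lemma le_mul_of_sq_le_mul_of_le_geometric {b : ℕ → ℝ} {C r : ℝ} (hr : 0 ≤ r) (hb : ∀ k, 0 ≤ b k)
    (hconv : ∀ k, b (k + 1) ^ 2 ≤ b k * b (k + 2)) (hC : ∀ k, b k ≤ C * r ^ k) :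
    b 1 ≤ r * b 0 := by
  by_contra! hlt
  have hb1 : 0 < b 1 := (mul_nonneg hr (hb 0)).trans_lt hlt
  have hb0 : 0 < b 0 := by
    refine (hb 0).lt_of_ne fun h ↦ ?_
    have := hconv 0
    rw [← h, zero_mul] at this
    simp only [zero_add] at this
    nlinarith
  set q := b 1 / b 0 with hq
  have hq0 : 0 < q := by positivity
  have hrq : r < q := by rwa [hq, lt_div_iff₀ hb0]
  have hstep : ∀ k, 0 < b k ∧ q * b k ≤ b (k + 1) := by
    intro k
    induction k with
    | zero => exact ⟨hb0, by rw [hq]; field_simp; simp⟩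
    | succ k ih =>
      obtain ⟨hk, hqk⟩ := ih
      have hk1 : 0 < b (k + 1) := (by positivity : 0 < q * b k).trans_le hqk
      refine ⟨hk1, ?_⟩
      have h1 := hconv k
      have h2 : b k * (q * b (k + 1)) ≤ b k * b (k + 2) := by nlinarith
      exact le_of_mul_le_mul_left h2 hk
  have hgeom : ∀ k, q ^ k * b 0 ≤ b k := by
    intro k
    induction k with
    | zero => simp
    | succ k ih =>
      calc q ^ (k + 1) * b 0 = q * (q ^ k * b 0) := by ring
        _ ≤ q * b k := by gcongr
        _ ≤ b (k + 1) := (hstep k).2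
  have hlim : Tendsto (fun k ↦ C * (r / q) ^ k) atTop (𝓝 (C * 0)) :=
    (tendsto_pow_atTop_nhds_zero_of_lt_one (by positivity) ((div_lt_one hq0).2 hrq)).const_mul C
  have hle : b 0 ≤ C * 0 := by
    refine ge_of_tendsto' hlim fun k ↦ ?_
    rw [div_pow, ← mul_div_assoc, le_div_iff₀ (by positivity), mul_comm]
    exact (hgeom k).trans (hC k)
  linarith

/-- The Cauchy-Schwarz inequality for the covariance. -/
lemma covariance_sq_le_variance_mul_variance {Ω : Type*} [MeasurableSpace Ω] {μ : Measure Ω}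
    [IsProbabilityMeasure μ] {X Y : Ω → ℝ} (hX : MemLp X 2 μ) (hY : MemLp Y 2 μ) :
    cov[X, Y; μ] ^ 2 ≤ Var[X; μ] * Var[Y; μ] := by
  have h : ∀ t : ℝ, 0 ≤ Var[Y; μ] * (t * t) + 2 * cov[X, Y; μ] * t + Var[X; μ] := by
    intro t
    have := variance_nonneg (X + t • Y) μ
    rw [variance_add hX (hY.const_smul t), covariance_smul_right, variance_smul] at this
    linarith
  have := discrim_le_zero h
  rw [discrim] at this
  nlinarith

lemma pi_absolutelyContinuous {n : ℕ} {α : Type*} [MeasurableSpace α] {μ ν : Measure α}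
    [SigmaFinite μ] [SigmaFinite ν] (h : μ ≪ ν) :
    Measure.pi (fun _ : Fin n ↦ μ) ≪ Measure.pi (fun _ : Fin n ↦ ν) := by
  induction n with
  | zero => rw [Measure.pi_of_empty, Measure.pi_of_empty]
  | succ n ih =>
    rw [← ((measurePreserving_piFinSuccAbove (fun _ : Fin (n + 1) ↦ μ) 0).symm _).map_eq,
      ← ((measurePreserving_piFinSuccAbove (fun _ : Fin (n + 1) ↦ ν) 0).symm _).map_eq]
    exact (h.prod ih).map (MeasurableEquiv.measurable _)

lemma gaussianPi_eq_stdGaussian (n : ℕ) :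
    gaussianPi n = stdGaussian (EuclideanSpace ℝ (Fin n)) :=
  map_pi_eq_stdGaussian

lemma gaussianPi_absolutelyContinuous (n : ℕ) : gaussianPi n ≪ volume := by
  rw [gaussianPi, ← (PiLp.volume_preserving_toLp (Fin n)).map_eq]
  exact (pi_absolutelyContinuous (gaussianReal_absolutelyContinuous 0 one_ne_zero)).map
    (MeasurableEquiv.measurable _)

section Lipschitz

variable {E : Type*} [NormedAddCommGroup E] [MeasurableSpace E] [BorelSpace E]
  {μ : Measure E} {f : E → ℝ} {K : ℝ≥0}

lemma LipschitzWith.memLp_two [IsFiniteMeasure μ] (hf : LipschitzWith K f) (hμ : MemLp id 2 μ) :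
    MemLp f 2 μ := by
  refine MemLp.of_le ((memLp_const ‖f 0‖).add (hμ.norm.const_mul (K : ℝ)))
    hf.continuous.aestronglyMeasurable (ae_of_all _ fun x ↦ ?_)
  have h := hf.dist_le_mul x 0
  rw [dist_zero_right, Real.dist_eq] at h
  have h' : |f x| ≤ |f x - f 0| + |f 0| := by simpa using abs_add_le (f x - f 0) (f 0)
  simp only [Pi.add_apply, Real.norm_eq_abs, id]
  exact (h'.trans (by linarith)).trans (le_abs_self _)

lemma LipschitzWith.variance_le [IsProbabilityMeasure μ] (hf : LipschitzWith K f)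
    (hμ : MemLp id 2 μ) : Var[f; μ] ≤ K ^ 2 * ∫ x, ‖x‖ ^ 2 ∂μ := by
  have hfm := hf.continuous.aestronglyMeasurable (μ := μ)
  have hint : Integrable (fun x ↦ ‖x‖ ^ 2) μ := hμ.integrable_norm_pow (by norm_num)
  rw [← variance_sub_const hfm (f 0), ← integral_const_mul]
  refine (variance_le_expectation_sq (hfm.sub aestronglyMeasurable_const)).trans ?_
  refine integral_mono_of_nonneg (ae_of_all _ fun x ↦ sq_nonneg _) (hint.const_mul _)
    (ae_of_all _ fun x ↦ ?_)
  have h := hf.dist_le_mul x 0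
  rw [dist_zero_right, Real.dist_eq] at h
  have := pow_le_pow_left₀ (abs_nonneg _) h 2
  simpa [mul_pow] using this

end Lipschitz

lemma integral_prod_sub_sq {Ω : Type*} [MeasurableSpace Ω] {μ : Measure Ω}
    [IsProbabilityMeasure μ] {f : Ω → ℝ} (hf : MemLp f 2 μ) :
    ∫ p, (f p.1 - f p.2) ^ 2 ∂(μ.prod μ) = 2 * Var[f; μ] := by
  have h1 : MemLp (fun p : Ω × Ω ↦ f p.1) 2 (μ.prod μ) := hf.comp_fst μ
  have h2 : MemLp (fun p : Ω × Ω ↦ f p.2) 2 (μ.prod μ) := hf.comp_snd μ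
  have hexp : ∀ p : Ω × Ω, (f p.1 - f p.2) ^ 2 = f p.1 ^ 2 + f p.2 ^ 2 - 2 * (f p.1 * f p.2) :=
    fun p ↦ by ring
  simp_rw [hexp]
  have h12 : Integrable (fun p : Ω × Ω ↦ 2 * (f p.1 * f p.2)) (μ.prod μ) :=
    (h1.integrable_mul h2).const_mul 2
  have hadd : Integrable (fun p : Ω × Ω ↦ f p.1 ^ 2 + f p.2 ^ 2) (μ.prod μ) :=
    h1.integrable_sq.add h2.integrable_sq
  rw [integral_sub hadd h12,
    integral_add h1.integrable_sq h2.integrable_sq, integral_const_mul, integral_prod_mul,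
    integral_fun_fst (fun x ↦ f x ^ 2), integral_fun_snd (fun x ↦ f x ^ 2), variance_eq_sub hf]
  simp
  ring

lemma funVariance_eq_ofReal_variance {Ω : Type*} [MeasurableSpace Ω] {μ : Measure Ω}
    [IsProbabilityMeasure μ] {f : Ω → ℝ} (hf : MemLp f 2 μ) :
    funVariance μ f = ENNReal.ofReal Var[f; μ] := by
  have hint : Integrable (fun p : Ω × Ω ↦ (f p.1 - f p.2) ^ 2) (μ.prod μ) :=
    ((hf.comp_fst μ).sub (hf.comp_snd μ)).integrable_sq
  rw [funVariance, ← ofReal_integral_eq_lintegral_ofReal hint (ae_of_all _ fun p ↦ by positivity),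
    integral_prod_sub_sq hf, ENNReal.ofReal_mul two_pos.le, ← mul_assoc]
  simp [ENNReal.inv_mul_cancel]

section Mehler

variable {E : Type*} [NormedAddCommGroup E] [NormedSpace ℝ E] [MeasurableSpace E]

/-- The Mehler (Ornstein-Uhlenbeck) operator of correlation `cos θ` associated to `μ`. -/
noncomputable def mehler (μ : Measure E) (θ : ℝ) (f : E → ℝ) (x : E) : ℝ :=
  ∫ y, f (Real.cos θ • x + Real.sin θ • y) ∂μ

variable [BorelSpace E] [SecondCountableTopology E] [CompleteSpace E] {μ : Measure E}
  [IsGaussian μ] {f g : E → ℝ} {K L : ℝ≥0}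

lemma measurePreserving_rotation (hμ : ∫ x, x ∂μ = 0) (θ : ℝ) :
    MeasurePreserving (ContinuousLinearMap.rotation θ : E × E → E × E) (μ.prod μ) (μ.prod μ) :=
  ⟨by fun_prop, IsGaussian.map_rotation_eq_self hμ θ⟩

lemma measurePreserving_cos_smul_add_sin_smul (hμ : ∫ x, x ∂μ = 0) (θ : ℝ) :
    MeasurePreserving (fun p : E × E ↦ Real.cos θ • p.1 + Real.sin θ • p.2) (μ.prod μ) μ :=
  measurePreserving_fst.comp (measurePreserving_rotation hμ θ)

lemma measurePreserving_neg_of_integral_eq_zero (hμ : ∫ x, x ∂μ = 0) :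
    MeasurePreserving (fun x : E ↦ -x) μ μ := by
  refine ⟨measurable_neg, ?_⟩
  have h := (measurePreserving_cos_smul_add_sin_smul hμ Real.pi).map_eq
  have hfst : (μ.prod μ).map Prod.fst = μ := measurePreserving_fst.map_eq
  conv_lhs => rw [← hfst]
  rw [Measure.map_map measurable_neg measurable_fst]
  simpa [Function.comp_def] using h

/-- The reflection `(x, y) ↦ (cos θ x + sin θ y, sin θ x - cos θ y)` preserves `μ ⊗ μ`. -/
lemma measurePreserving_reflection (hμ : ∫ x, x ∂μ = 0) (θ : ℝ) :
    MeasurePreserving (fun p : E × E ↦ (Real.cos θ • p.1 + Real.sin θ • p.2,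
      Real.sin θ • p.1 - Real.cos θ • p.2)) (μ.prod μ) (μ.prod μ) := by
  have h := ((MeasurePreserving.id μ).prod (measurePreserving_neg_of_integral_eq_zero hμ)).comp
    (measurePreserving_rotation hμ θ)
  convert h using 2 with p
  simp [ContinuousLinearMap.rotation_apply, sub_eq_add_neg, add_comm]

lemma LipschitzWith.memLp_cos_smul_add_sin_smul (hf : LipschitzWith K f) (hμ : ∫ x, x ∂μ = 0)
    (θ : ℝ) :
    MemLp (fun p : E × E ↦ f (Real.cos θ • p.1 + Real.sin θ • p.2)) 2 (μ.prod μ) :=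
  (hf.memLp_two IsGaussian.memLp_two_id).comp_measurePreserving
    (measurePreserving_cos_smul_add_sin_smul hμ θ)

lemma LipschitzWith.integrable_cos_smul_add_sin_smul (hf : LipschitzWith K f) (θ : ℝ) (x : E) :
    Integrable (fun y ↦ f (Real.cos θ • x + Real.sin θ • y)) μ := by
  have hlip : LipschitzWith (K * ‖Real.sin θ‖₊) (fun y ↦ f (Real.cos θ • x + Real.sin θ • y)) := by
    refine LipschitzWith.of_dist_le_mul fun y z ↦ (hf.dist_le_mul _ _).trans_eq ?_
    rw [dist_add_left, dist_smul₀]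
    simp [mul_assoc]
  exact (hlip.memLp_two IsGaussian.memLp_two_id).integrable one_le_two

lemma LipschitzWith.mehler (hf : LipschitzWith K f) (θ : ℝ) :
    LipschitzWith (K * ‖Real.cos θ‖₊) (mehler μ θ f) := by
  refine LipschitzWith.of_dist_le_mul fun x z ↦ ?_
  rw [Real.dist_eq, _root_.mehler, _root_.mehler, ← integral_sub
    (hf.integrable_cos_smul_add_sin_smul θ x) (hf.integrable_cos_smul_add_sin_smul θ z),
    ← Real.norm_eq_abs]
  refine (norm_integral_le_of_norm_le_const (C := (K * ‖Real.cos θ‖₊ : ℝ≥0) * dist x z)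
    (ae_of_all _ fun y ↦ ?_)).trans_eq (by simp)
  rw [← dist_eq_norm]
  refine (hf.dist_le_mul _ _).trans_eq ?_
  rw [dist_add_right, dist_smul₀]
  simp [mul_assoc]

lemma LipschitzWith.iterate_mehler (hf : LipschitzWith K f) (θ : ℝ) (k : ℕ) :
    LipschitzWith (K * ‖Real.cos θ‖₊ ^ k) ((_root_.mehler μ θ)^[k] f) := by
  induction k with
  | zero => simpa using hf
  | succ k ih =>
    rw [Function.iterate_succ_apply', pow_succ, ← mul_assoc]
    exact ih.mehler θ

lemma integral_mul_mehler (hμ : ∫ x, x ∂μ = 0) (hf : LipschitzWith K f) (hg : LipschitzWith L g)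
    (θ : ℝ) :
    ∫ x, f x * mehler μ θ g x ∂μ =
      ∫ p, f p.1 * g (Real.cos θ • p.1 + Real.sin θ • p.2) ∂(μ.prod μ) := by
  have hint : Integrable (fun p : E × E ↦ f p.1 * g (Real.cos θ • p.1 + Real.sin θ • p.2))
      (μ.prod μ) := ((hf.memLp_two IsGaussian.memLp_two_id).comp_fst μ).integrable_mul
        (hg.memLp_cos_smul_add_sin_smul hμ θ)
  rw [integral_prod _ hint]
  simp_rw [integral_const_mul]
  rfl

lemma integral_mul_mehler_comm (hμ : ∫ x, x ∂μ = 0) (hf : LipschitzWith K f)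
    (hg : LipschitzWith L g) (θ : ℝ) :
    ∫ x, f x * mehler μ θ g x ∂μ = ∫ x, mehler μ θ f x * g x ∂μ := by
  have hfc := hf.continuous
  have hgc := hg.continuous
  have hΦ := measurePreserving_reflection hμ θ
  simp_rw [mul_comm (mehler μ θ f _)]
  rw [integral_mul_mehler hμ hf hg, integral_mul_mehler hμ hg hf]
  conv_rhs => rw [← hΦ.map_eq]
  rw [integral_map hΦ.measurable.aemeasurable (Continuous.aestronglyMeasurable (by fun_prop))]
  refine integral_congr_ae (ae_of_all _ fun p ↦ ?_)
  have : Real.cos θ • (Real.cos θ • p.1 + Real.sin θ • p.2) +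
      Real.sin θ • (Real.sin θ • p.1 - Real.cos θ • p.2) = p.1 := by
    have h : (Real.cos θ * Real.cos θ + Real.sin θ * Real.sin θ) • p.1 = p.1 := by
      rw [← sq, ← sq, Real.cos_sq_add_sin_sq, one_smul]
    conv_rhs => rw [← h]
    module
  simp only [this, mul_comm]

lemma integral_mehler (hμ : ∫ x, x ∂μ = 0) (hf : LipschitzWith K f) (θ : ℝ) :
    ∫ x, mehler μ θ f x ∂μ = ∫ x, f x ∂μ := by
  have h := integral_mul_mehler_comm hμ (LipschitzWith.const (α := E) (1 : ℝ)) hf θ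
  simpa [mehler] using h

lemma covariance_mehler_comm (hμ : ∫ x, x ∂μ = 0) (hf : LipschitzWith K f)
    (hg : LipschitzWith L g) (θ : ℝ) :
    cov[f, mehler μ θ g; μ] = cov[mehler μ θ f, g; μ] := by
  have hid : MemLp id 2 μ := IsGaussian.memLp_two_id
  rw [covariance_eq_sub (hf.memLp_two hid) ((hg.mehler θ).memLp_two hid),
    covariance_eq_sub ((hf.mehler θ).memLp_two hid) (hg.memLp_two hid), integral_mehler hμ hf,
    integral_mehler hμ hg]
  simp only [Pi.mul_apply, integral_mul_mehler_comm hμ hf hg]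

/-- The Mehler operator of correlation `cos θ` contracts the variance by `cos θ ^ 2`. -/
lemma variance_mehler_le (hμ : ∫ x, x ∂μ = 0) (hf : LipschitzWith K f) (θ : ℝ) :
    Var[mehler μ θ f; μ] ≤ Real.cos θ ^ 2 * Var[f; μ] := by
  have hid : MemLp id 2 μ := IsGaussian.memLp_two_id
  have hL := hf.iterate_mehler (μ := μ) θ
  refine le_mul_of_sq_le_mul_of_le_geometric (b := fun k ↦ Var[(mehler μ θ)^[k] f; μ])
    (C := K ^ 2 * ∫ x, ‖x‖ ^ 2 ∂μ) (sq_nonneg _) (fun k ↦ variance_nonneg _ _) (fun k ↦ ?_)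
    fun k ↦ ?_
  · have h : Var[(mehler μ θ)^[k + 1] f; μ] =
        cov[(mehler μ θ)^[k] f, (mehler μ θ)^[k + 2] f; μ] := by
      rw [← covariance_self (hL (k + 1)).continuous.aemeasurable,
        Function.iterate_succ_apply' _ (k + 1), covariance_mehler_comm hμ (hL k) (hL (k + 1)),
        ← Function.iterate_succ_apply' (mehler μ θ) k f]
    simp only [h]
    exact covariance_sq_le_variance_mul_variance ((hL k).memLp_two hid)
      ((hL (k + 2)).memLp_two hid)
  · refine ((hL k).variance_le hid).trans_eq ?_
    push_cast
    rw [Real.norm_eq_abs, mul_pow, ← pow_mul, mul_comm k 2, pow_mul, sq_abs]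
    ring

/-- The spectral gap of the Mehler operator, as a Poincaré inequality for finite rotations. -/
lemma variance_mul_one_sub_cos_le (hμ : ∫ x, x ∂μ = 0) (hf : LipschitzWith K f) {θ : ℝ}
    (hθ : 0 ≤ Real.cos θ) :
    2 * (1 - Real.cos θ) * Var[f; μ] ≤
      ∫ p, (f (Real.cos θ • p.1 + Real.sin θ • p.2) - f p.1) ^ 2 ∂(μ.prod μ) := by
  have hid : MemLp id 2 μ := IsGaussian.memLp_two_id
  have hf2 := hf.memLp_two hid
  have hT2 := (hf.mehler (μ := μ) θ).memLp_two hid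
  have hcov : cov[f, mehler μ θ f; μ] ≤ Real.cos θ * Var[f; μ] := by
    refine le_of_sq_le_sq ?_ (mul_nonneg hθ (variance_nonneg _ _))
    calc cov[f, mehler μ θ f; μ] ^ 2 ≤ Var[f; μ] * Var[mehler μ θ f; μ] :=
          covariance_sq_le_variance_mul_variance hf2 hT2
      _ ≤ Var[f; μ] * (Real.cos θ ^ 2 * Var[f; μ]) := by
          gcongr
          · exact variance_nonneg _ _
          · exact variance_mehler_le hμ hf θ
      _ = (Real.cos θ * Var[f; μ]) ^ 2 := by ring
  have h1 : MemLp (fun p : E × E ↦ f p.1) 2 (μ.prod μ) := hf2.comp_fst μ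
  have h2 := hf.memLp_cos_smul_add_sin_smul hμ θ
  have hsq : ∫ p, f (Real.cos θ • p.1 + Real.sin θ • p.2) ^ 2 ∂(μ.prod μ) = ∫ x, f x ^ 2 ∂μ := by
    have hm := measurePreserving_cos_smul_add_sin_smul hμ θ
    have hc := hf.continuous
    conv_rhs => rw [← hm.map_eq]
    rw [integral_map hm.measurable.aemeasurable (Continuous.aestronglyMeasurable (by fun_prop))]
  have hexp : ∀ p : E × E, (f (Real.cos θ • p.1 + Real.sin θ • p.2) - f p.1) ^ 2 =
      f (Real.cos θ • p.1 + Real.sin θ • p.2) ^ 2 + f p.1 ^ 2 -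
        2 * (f p.1 * f (Real.cos θ • p.1 + Real.sin θ • p.2)) := fun p ↦ by ring
  have h12 : Integrable (fun p : E × E ↦
      2 * (f p.1 * f (Real.cos θ • p.1 + Real.sin θ • p.2))) (μ.prod μ) :=
    (h1.integrable_mul h2).const_mul 2
  have hadd : Integrable (fun p : E × E ↦
      f (Real.cos θ • p.1 + Real.sin θ • p.2) ^ 2 + f p.1 ^ 2) (μ.prod μ) :=
    h2.integrable_sq.add h1.integrable_sq
  simp_rw [hexp]
  rw [integral_sub hadd h12, integral_add h2.integrable_sq h1.integrable_sq, integral_const_mul,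
    ← integral_mul_mehler hμ hf hf, hsq, integral_fun_fst (fun x ↦ f x ^ 2)]
  rw [covariance_eq_sub hf2 hT2, integral_mehler hμ hf] at hcov
  have hvar := variance_eq_sub hf2
  simp only [Pi.pow_apply, Pi.mul_apply, probReal_univ, one_smul] at hcov hvar ⊢
  nlinarith

end Mehler

section Rotation

variable {E : Type*} [NormedAddCommGroup E] [NormedSpace ℝ E] {f : E → ℝ}

lemma DifferentiableAt.tendsto_div_rotation {x : E} (hf : DifferentiableAt ℝ f x) (y : E) :
    Tendsto (fun θ : ℝ ↦ (f (Real.cos θ • x + Real.sin θ • y) - f x) / θ) (𝓝[≠] 0)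
      (𝓝 (fderiv ℝ f x y)) := by
  have hγ : HasDerivAt (fun θ : ℝ ↦ Real.cos θ • x + Real.sin θ • y) y 0 := by
    simpa using ((Real.hasDerivAt_cos 0).smul_const x).fun_add
      ((Real.hasDerivAt_sin 0).smul_const y)
  have hf' : HasFDerivAt f (fderiv ℝ f x) (Real.cos 0 • x + Real.sin 0 • y) := by
    simpa using hf.hasFDerivAt
  have h := (hf'.comp_hasDerivAt (0 : ℝ) hγ).tendsto_slope_zero
  simpa [div_eq_inv_mul, Function.comp_def] using h

lemma LipschitzWith.div_rotation_sq_le (hf : LipschitzWith 1 f) (x y : E) (θ : ℝ) :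
    ((f (Real.cos θ • x + Real.sin θ • y) - f x) / θ) ^ 2 ≤ (‖x‖ + ‖y‖) ^ 2 := by
  rcases eq_or_ne θ 0 with rfl | hθ
  · rw [_root_.div_zero, zero_pow two_ne_zero]
    positivity
  have h1 : |f (Real.cos θ • x + Real.sin θ • y) - f x| ≤ |θ| * (‖x‖ + ‖y‖) := by
    have h := hf.dist_le_mul (Real.cos θ • x + Real.sin θ • y) x
    rw [Real.dist_eq, dist_eq_norm, NNReal.coe_one, one_mul] at h
    have hcos : |Real.cos θ - 1| ≤ |θ| := by
      simpa using Real.abs_cos_sub_cos_le θ 0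
    calc |f (Real.cos θ • x + Real.sin θ • y) - f x|
        ≤ ‖Real.cos θ • x + Real.sin θ • y - x‖ := h
      _ = ‖(Real.cos θ - 1) • x + Real.sin θ • y‖ := by congr 1; module
      _ ≤ |Real.cos θ - 1| * ‖x‖ + |Real.sin θ| * ‖y‖ := by
          refine (norm_add_le _ _).trans_eq ?_
          simp [norm_smul]
      _ ≤ |θ| * ‖x‖ + |θ| * ‖y‖ := by
          exact add_le_add (mul_le_mul_of_nonneg_right hcos (norm_nonneg _))
            (mul_le_mul_of_nonneg_right Real.abs_sin_le_abs (norm_nonneg _))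
      _ = |θ| * (‖x‖ + ‖y‖) := by ring
  rw [sq_le_sq, abs_div, abs_of_nonneg (by positivity : 0 ≤ ‖x‖ + ‖y‖),
    div_le_iff₀ (abs_pos.2 hθ), mul_comm]
  exact h1

end Rotation

section Poincare

variable {E : Type*} [NormedAddCommGroup E] [InnerProductSpace ℝ E] [FiniteDimensional ℝ E]
  [MeasurableSpace E] [BorelSpace E] {f : E → ℝ}

lemma integral_sq_strongDual_stdGaussian (L : StrongDual ℝ E) :
    ∫ y, L y ^ 2 ∂(stdGaussian E) = ‖L‖ ^ 2 := by
  rw [← variance_dual_stdGaussian L, variance_of_integral_eq_zero L.continuous.aemeasurable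
    (integral_strongDual_stdGaussian L)]

lemma integral_fderiv_apply_sq_le_one (hf : LipschitzWith 1 f) :
    ∫ p, (fderiv ℝ f p.1 p.2) ^ 2 ∂((stdGaussian E).prod (stdGaussian E)) ≤ 1 := by
  have hnorm : ∀ x, ‖fderiv ℝ f x‖ ≤ 1 := fun x ↦ by
    simpa using norm_fderiv_le_of_lipschitz ℝ hf (x₀ := x)
  have hmeas : Measurable fun p : E × E ↦ fderiv ℝ f p.1 p.2 :=
    isBoundedBilinearMap_apply.continuous.measurable.comp
      (((measurable_fderiv ℝ f).comp measurable_fst).prodMk measurable_snd)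
  have hid : MemLp (fun p : E × E ↦ p.2) 2 ((stdGaussian E).prod (stdGaussian E)) :=
    (IsGaussian.memLp_two_fun_id (μ := stdGaussian E)).comp_snd _
  have hmem : MemLp (fun p : E × E ↦ fderiv ℝ f p.1 p.2) 2
      ((stdGaussian E).prod (stdGaussian E)) := by
    refine hid.of_le hmeas.aestronglyMeasurable (ae_of_all _ fun p ↦ ?_)
    simpa using (fderiv ℝ f p.1).le_of_opNorm_le (hnorm p.1) p.2
  rw [integral_prod _ hmem.integrable_sq]
  simp_rw [integral_sq_strongDual_stdGaussian]
  refine (integral_mono_of_nonneg (ae_of_all _ fun x ↦ by positivity) (integrable_const 1)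
    (ae_of_all _ fun x ↦ pow_le_one₀ (norm_nonneg _) (hnorm x))).trans_eq (by simp)

/-- The Gaussian Poincaré inequality for Lipschitz functions, with the sharp constant. -/
theorem LipschitzWith.variance_stdGaussian_le_one (hac : stdGaussian E ≪ volume)
    (hf : LipschitzWith 1 f) : Var[f; stdGaussian E] ≤ 1 := by
  set μ := stdGaussian E with hμ
  have hdiff : ∀ᵐ p ∂(μ.prod μ), DifferentiableAt ℝ f p.1 :=
    Measure.quasiMeasurePreserving_fst.ae (hac.ae_le hf.ae_differentiableAt)
  have hbound : Integrable (fun p : E × E ↦ (‖p.1‖ + ‖p.2‖) ^ 2) (μ.prod μ) :=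
    ((IsGaussian.memLp_two_fun_id.norm.comp_fst μ).add
      (IsGaussian.memLp_two_fun_id.norm.comp_snd μ)).integrable_sq
  have hc := hf.continuous
  have hlim : Tendsto (fun θ : ℝ ↦ ∫ p,
      ((f (Real.cos θ • p.1 + Real.sin θ • p.2) - f p.1) / θ) ^ 2 ∂(μ.prod μ)) (𝓝[≠] 0)
      (𝓝 (∫ p, (fderiv ℝ f p.1 p.2) ^ 2 ∂(μ.prod μ))) := by
    refine tendsto_integral_filter_of_dominated_convergence _
      (Eventually.of_forall fun θ ↦ Continuous.aestronglyMeasurable (by fun_prop))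
      (Eventually.of_forall fun θ ↦ ae_of_all _ fun p ↦ ?_) hbound ?_
    · rw [Real.norm_of_nonneg (sq_nonneg _)]
      exact hf.div_rotation_sq_le p.1 p.2 θ
    · filter_upwards [hdiff] with p hp
      exact (hp.tendsto_div_rotation p.2).pow 2
  have hlow : Tendsto (fun θ : ℝ ↦ (1 - 5 / 48 * θ ^ 2) * Var[f; μ]) (𝓝[≠] 0)
      (𝓝 Var[f; μ]) := by
    have : ContinuousAt (fun θ : ℝ ↦ (1 - 5 / 48 * θ ^ 2) * Var[f; μ]) 0 := by fun_prop
    simpa using this.tendsto.mono_left nhdsWithin_le_nhds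
  refine (le_of_tendsto_of_tendsto hlow hlim ?_).trans (integral_fderiv_apply_sq_le_one hf)
  have hball : Set.Icc (-1 : ℝ) 1 ∈ 𝓝[≠] (0 : ℝ) :=
    nhdsWithin_le_nhds (Icc_mem_nhds (by norm_num) (by norm_num))
  filter_upwards [self_mem_nhdsWithin, hball] with θ hθ0 hθ1
  have hθ : |θ| ≤ 1 := abs_le.2 hθ1
  have hθpos : 0 < θ ^ 2 := by
    have : θ ≠ 0 := hθ0
    positivity
  have hgap := variance_mul_one_sub_cos_le (μ := μ) integral_id_stdGaussian hf
    (Real.cos_nonneg_of_mem_Icc ⟨by linarith [hθ1.1, Real.pi_gt_three],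
      by linarith [hθ1.2, Real.pi_gt_three]⟩ : 0 ≤ Real.cos θ)
  simp_rw [div_pow]
  rw [integral_div, le_div_iff₀ hθpos]
  refine le_trans ?_ hgap
  have hcos := (abs_le.1 (Real.cos_bound hθ)).2
  have hpow : |θ| ^ 4 = θ ^ 2 * θ ^ 2 := by rw [show 4 = 2 * 2 by rfl, pow_mul, sq_abs, sq]
  rw [hpow] at hcos
  rw [mul_right_comm]
  exact mul_le_mul_of_nonneg_right (by nlinarith) (variance_nonneg _ _)

end Poincare

/-- The (observable) variance of the `n`-dimensional standard Gaussian space equals 1: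
the supremum over 1-Lipschitz functions `f : ℝⁿ → ℝ` of
`(1/2)∫_{ℝⁿ×ℝⁿ} (f x − f y)² d(γⁿ ⊗ γⁿ)` is `1`. -/
theorem variance_gaussianPi (n : ℕ) (hn : 1 ≤ n) :
    (⨆ f ∈ {f : EuclideanSpace ℝ (Fin n) → ℝ | LipschitzWith 1 f},
      funVariance (gaussianPi n) f) = 1 := by
  have hac := gaussianPi_absolutelyContinuous n
  rw [gaussianPi_eq_stdGaussian] at hac ⊢
  have hvar : ∀ f : EuclideanSpace ℝ (Fin n) → ℝ, LipschitzWith 1 f →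
      funVariance (stdGaussian (EuclideanSpace ℝ (Fin n))) f =
        ENNReal.ofReal Var[f; stdGaussian (EuclideanSpace ℝ (Fin n))] := fun f hf ↦
    funVariance_eq_ofReal_variance (hf.memLp_two IsGaussian.memLp_two_id)
  apply le_antisymm
  · refine iSup₂_le fun f hf ↦ ?_
    rw [hvar f hf, ENNReal.ofReal_le_one]
    exact hf.variance_stdGaussian_le_one hac
  · let i : Fin n := ⟨0, hn⟩
    have hlip : LipschitzWith 1 fun x : EuclideanSpace ℝ (Fin n) ↦ x i :=
      LipschitzWith.of_dist_le_mul fun x y ↦ by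
        simpa [Real.dist_eq, dist_eq_norm] using PiLp.norm_apply_le (x - y) i
    have hone : Var[fun x : EuclideanSpace ℝ (Fin n) ↦ x i;
        stdGaussian (EuclideanSpace ℝ (Fin n))] = 1 := by
      rw [← multivariateGaussian_zero_one, variance_eval_multivariateGaussian Matrix.PosSemidef.one,
        Matrix.one_apply_eq]
    refine le_iSup₂_of_le (fun x ↦ x i) hlip ?_
    rw [hvar _ hlip, hone, ENNReal.ofReal_one]
end

section
/- Let X be a complete separable metric space with a Borel probability measure m, and let α : ℕ → [0,∞) be a sequence with ∑_{i=1}^∞ α_i ≤ 1. Suppose that for every N ≥ 1 there exists a map f_N : {1,…,N} → X such that ∑_{i=1}^N α_i δ_{f_N(i)} ≤ m as measures. Then m has atoms α, i.e., there exists f : ℕ → X with ∑_{i=1}^∞ α_i δ_{f(i)} ≤ m. (Equivalently, 𝒳_α = ⋂_{N≥1} 𝒳_{α[N]}, where α[N] is the truncation of α after the N-th term.) -/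
open MeasureTheory ENNReal

/-- A finite measure has only finitely many atoms of mass at least a given positive constant. -/
theorem finite_setOf_le_measure_singleton {X : Type*} [MeasurableSpace X]
    [MeasurableSingletonClass X] (m : Measure X) [IsFiniteMeasure m] {c : ℝ≥0∞} (hc : 0 < c) :
    {x | c ≤ m {x}}.Finite :=
  Measure.finite_const_le_meas_of_disjoint_iUnion m hc (fun x => measurableSet_singleton x)
    (fun x y hxy => by simpa using hxy) (measure_ne_top m _)

/-- If every finite truncation of a weight sequence is realized by atoms of a finite measure,
then so is the whole sequence. -/
theorem exists_sum_smul_dirac_le {X : Type*} [MeasurableSpace X] [MeasurableSingletonClass X]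
    (m : Measure X) [IsFiniteMeasure m] (c : ℕ → ℝ≥0∞) (f : ℕ → ℕ → X)
    (hf : ∀ N, ∑ i ∈ Finset.range N, c i • Measure.dirac (f N i) ≤ m) :
    ∃ g : ℕ → X, Measure.sum (fun i => c i • Measure.dirac (g i)) ≤ m := by
  let U : Ultrafilter ℕ := Filter.hyperfilter ℕ
  have large (n : ℕ) : ∀ᶠ N in (U : Filter ℕ), n ≤ N :=
    Nat.hyperfilter_le_atTop (Filter.eventually_ge_atTop n)
  have limit (i : ℕ) : ∃ x, ∀ᶠ N in (U : Filter ℕ),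
      c i • Measure.dirac (f N i) = c i • Measure.dirac x := by
    rcases eq_or_ne (c i) 0 with hi | hi
    · exact ⟨f 0 0, by simp [hi]⟩
    have atom : ∀ᶠ N in (U : Filter ℕ), ∃ x ∈ {x | c i ≤ m {x}}, f N i = x := by
      filter_upwards [large (i + 1)] with N hN
      refine ⟨f N i, ?_, rfl⟩
      calc c i = (c i • Measure.dirac (f N i)) {f N i} := by simp
        _ ≤ ∑ j ∈ Finset.range N, (c j • Measure.dirac (f N j)) {f N i} :=
          Finset.single_le_sum (f := fun j => (c j • Measure.dirac (f N j)) {f N i})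
            (fun _ _ => zero_le) (Finset.mem_range.2 hN)
        _ ≤ m {f N i} := by simpa only [Measure.finsetSum_apply] using hf N {f N i}
    obtain ⟨x, -, hx⟩ := (Ultrafilter.eventually_exists_mem_iff
      (finite_setOf_le_measure_singleton m (pos_iff_ne_zero.2 hi))).1 atom
    exact ⟨x, hx.mono fun N hN => by rw [hN]⟩
  choose g hg using limit
  refine ⟨g, Measure.le_iff.2 fun s hs => ?_⟩
  rw [Measure.sum_apply _ hs, ENNReal.tsum_eq_iSup_nat]
  refine iSup_le fun n => ?_
  obtain ⟨N, hN, hnN⟩ := (((Filter.eventually_all_finset (Finset.range n)).2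
    fun i _ => hg i).and (large n)).exists
  calc ∑ i ∈ Finset.range n, (c i • Measure.dirac (g i)) s
      = ∑ i ∈ Finset.range n, (c i • Measure.dirac (f N i)) s :=
        Finset.sum_congr rfl fun i hi => by rw [hN i hi]
    _ ≤ ∑ i ∈ Finset.range N, (c i • Measure.dirac (f N i)) s :=
        Finset.sum_le_sum_of_subset (Finset.range_mono hnN)
    _ ≤ m s := by simpa only [Measure.finsetSum_apply] using hf N s

open MeasureTheory ENNReal

/-- If every finite truncation of the atom sequence `α` is realized in `m`
(for every `N` there is `f_N` with `∑_{i<N} α_i δ_{f_N(i)} ≤ m`), then the whole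
sequence of atoms is realized: there is `f : ℕ → X` with `∑_i α_i δ_{f(i)} ≤ m`.
Equivalently, `𝒳_α = ⋂_N 𝒳_{α[N]}`. -/
theorem hasAtoms_of_forall_truncation {X : Type*} [MetricSpace X] [CompleteSpace X]
    [TopologicalSpace.SeparableSpace X] [MeasurableSpace X] [BorelSpace X]
    (m : Measure X) [IsProbabilityMeasure m]
    (α : ℕ → ℝ) (hα : ∀ i, 0 ≤ α i) (hsum : ∀ N, ∑ i ∈ Finset.range N, α i ≤ 1)
    (h : ∀ N : ℕ, ∃ f : ℕ → X,
      (∑ i ∈ Finset.range N, ENNReal.ofReal (α i) • Measure.dirac (f i)) ≤ m) :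
    ∃ f : ℕ → X, Measure.sum (fun i => ENNReal.ofReal (α i) • Measure.dirac (f i)) ≤ m := by
  choose f hf using h
  exact exists_sum_smul_dirac_le m (fun i => ENNReal.ofReal (α i)) f hf
end

section
/- Let α : ℕ → [0,∞) with ∑_{i=1}^∞ α_i ≤ 1, and let X and Y be complete separable metric spaces with Borel probability measures m_X and m_Y, each having atoms α. Then there exists a Borel probability measure m on the product X × Y, equipped with the maximum metric d((x,y),(x',y')) = max{d_X(x,x'), d_Y(y,y')}, such that the first-coordinate projection pushes m forward to m_X, the second-coordinate projection pushes m forward to m_Y, and m has atoms α. (Hence the set 𝒳_α of pm-spaces with atoms α is directed under the Lipschitz order.) -/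
open MeasureTheory ENNReal

/-- `m` has atoms `α` if there is `f : ℕ → X` with `∑_i α_i δ_{f(i)} ≤ m`. -/
def HasAtoms {X : Type*} [MeasurableSpace X] (α : ℕ → ℝ) (m : Measure X) : Prop :=
  ∃ f : ℕ → X, Measure.sum (fun i => ENNReal.ofReal (α i) • Measure.dirac (f i)) ≤ m

/-- A measure of the form `C + (ν univ)⁻¹ • μ.prod ν`, with `μ` and `ν` of equal finite mass,
has first marginal `map Prod.fst C + μ`. -/
theorem map_fst_add_inv_smul_prod {X Y : Type*} [MeasurableSpace X] [MeasurableSpace Y]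
    (C : Measure (X × Y)) (μ : Measure X) (ν : Measure Y) [IsFiniteMeasure μ] [IsFiniteMeasure ν]
    (h : μ Set.univ = ν Set.univ) :
    Measure.map Prod.fst (C + (ν Set.univ)⁻¹ • μ.prod ν) = Measure.map Prod.fst C + μ := by
  rw [Measure.map_add _ _ measurable_fst, Measure.map_smul, Measure.map_fst_prod, smul_smul]
  by_cases h0 : ν Set.univ = 0
  · have hμ : μ = 0 := by rwa [← Measure.measure_univ_eq_zero, h]
    simp [hμ]
  · rw [ENNReal.inv_mul_cancel h0 (measure_ne_top ν _), one_smul]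

/-- A measure of the form `C + (ν univ)⁻¹ • μ.prod ν`, with `μ` and `ν` of equal finite mass,
has second marginal `map Prod.snd C + ν`. -/
theorem map_snd_add_inv_smul_prod {X Y : Type*} [MeasurableSpace X] [MeasurableSpace Y]
    (C : Measure (X × Y)) (μ : Measure X) (ν : Measure Y) [IsFiniteMeasure μ] [IsFiniteMeasure ν]
    (h : μ Set.univ = ν Set.univ) :
    Measure.map Prod.snd (C + (ν Set.univ)⁻¹ • μ.prod ν) = Measure.map Prod.snd C + ν := by
  rw [Measure.map_add _ _ measurable_snd, Measure.map_smul, Measure.map_snd_prod, smul_smul, h]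
  by_cases h0 : ν Set.univ = 0
  · simp [Measure.measure_univ_eq_zero.mp h0]
  · rw [ENNReal.inv_mul_cancel h0 (measure_ne_top ν _), one_smul]

/-- The pushforward of a weighted sum of Dirac measures. -/
theorem map_sum_smul_dirac {X Y : Type*} [MeasurableSpace X] [MeasurableSpace Y] {g : X → Y}
    (hg : Measurable g) (w : ℕ → ℝ≥0∞) (f : ℕ → X) :
    Measure.map g (Measure.sum fun i => w i • Measure.dirac (f i)) =
      Measure.sum fun i => w i • Measure.dirac (g (f i)) := by
  rw [Measure.map_sum hg.aemeasurable]
  simp only [Measure.map_smul, Measure.map_dirac' hg]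

/-- Given two metric measure spaces whose measures have atoms `α`, there is a coupling
measure on the product (with the maximum metric, whose coordinate projections are
1-Lipschitz) which also has atoms `α`; hence the class `𝒳_α` is directed in the
Lipschitz order. -/
theorem exists_coupling_hasAtoms {X Y : Type*} [MetricSpace X] [MetricSpace Y]
    [CompleteSpace X] [CompleteSpace Y]
    [TopologicalSpace.SeparableSpace X] [TopologicalSpace.SeparableSpace Y]
    [MeasurableSpace X] [MeasurableSpace Y] [BorelSpace X] [BorelSpace Y]
    (α : ℕ → ℝ) (hα : ∀ i, 0 ≤ α i) (hsum : ∀ N, ∑ i ∈ Finset.range N, α i ≤ 1)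
    (mX : Measure X) (mY : Measure Y)
    [IsProbabilityMeasure mX] [IsProbabilityMeasure mY]
    (hX : HasAtoms α mX) (hY : HasAtoms α mY) :
    ∃ m : Measure (X × Y), IsProbabilityMeasure m ∧
      Measure.map Prod.fst m = mX ∧ Measure.map Prod.snd m = mY ∧ HasAtoms α m := by
  obtain ⟨f, hf⟩ := hX
  obtain ⟨g, hg⟩ := hY
  set A := Measure.sum fun i => ENNReal.ofReal (α i) • Measure.dirac (f i) with hA
  set B := Measure.sum fun i => ENNReal.ofReal (α i) • Measure.dirac (g i) with hB
  set C := Measure.sum fun i => ENNReal.ofReal (α i) • Measure.dirac (f i, g i) with hC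
  have : IsFiniteMeasure A := isFiniteMeasure_of_le mX hf
  have : IsFiniteMeasure B := isFiniteMeasure_of_le mY hg
  have hmass : (mX - A) Set.univ = (mY - B) Set.univ := by
    rw [Measure.sub_apply .univ hf, Measure.sub_apply .univ hg, measure_univ (μ := mX),
      measure_univ (μ := mY)]
    simp [hA, hB]
  have hfst : Measure.map Prod.fst (C + ((mY - B) Set.univ)⁻¹ • (mX - A).prod (mY - B)) = mX := by
    rw [map_fst_add_inv_smul_prod _ _ _ hmass, hC, map_sum_smul_dirac measurable_fst, add_comm]
    exact Measure.sub_add_cancel_of_le hf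
  have hsnd : Measure.map Prod.snd (C + ((mY - B) Set.univ)⁻¹ • (mX - A).prod (mY - B)) = mY := by
    rw [map_snd_add_inv_smul_prod _ _ _ hmass, hC, map_sum_smul_dirac measurable_snd, add_comm]
    exact Measure.sub_add_cancel_of_le hg
  refine ⟨_, ⟨?_⟩, hfst, hsnd, fun i => (f i, g i), Measure.le_add_right le_rfl⟩
  rw [← Set.preimage_univ (f := Prod.fst), ← Measure.map_apply measurable_fst .univ, hfst,
    measure_univ]
end
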